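/- Let F be a field with char F ∉ {2,3,7} and let c ∈ F satisfy c^2 + c + 2 = 0. With P_1 = zD_3, P_2 = xD_1, P_3 = yD_2 and Q_1 = zC_2, Q_2 = xC_2, Q_3 = y((y^2−z^2)D_2 + C_3) as in the context, the F-vector space R_5 of homogeneous quintics in R = F[x,y,z] decomposes as a direct sum R_5 = span_F{Q_1, Q_2, Q_3} ⊕ (P)_5, where (P)_5 denotes the degree-5 homogeneous component of the ideal P = (P_1, P_2, P_3); in particular Q_1, Q_2, Q_3 are linearly independent and no nonzero linear combination of them lies in P. -/

import Mathlib

open MvPolynomial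

noncomputable section

/-- `C₃ = 4x⁴+4y⁴+(3c+9)x²y²+(5c−1)x²z²+(5c−1)y²z²+(15c+25)z⁴`. -/
def C₃ {F : Type*} [Field F] (c : F) : MvPolynomial (Fin 3) F :=
  4 * X 0 ^ 4 + 4 * X 1 ^ 4 + C (3 * c + 9) * X 0 ^ 2 * X 1 ^ 2 +
    C (5 * c - 1) * X 0 ^ 2 * X 2 ^ 2 + C (5 * c - 1) * X 1 ^ 2 * X 2 ^ 2 +
    C (15 * c + 25) * X 2 ^ 4

/-- `C₁ = (15c+25)x⁴+4y⁴+(5c−1)x²y²+(5c−1)x²z²+(3c+9)y²z²+4z⁴`. -/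
def C₁ {F : Type*} [Field F] (c : F) : MvPolynomial (Fin 3) F :=
  C (15 * c + 25) * X 0 ^ 4 + 4 * X 1 ^ 4 + C (5 * c - 1) * X 0 ^ 2 * X 1 ^ 2 +
    C (5 * c - 1) * X 0 ^ 2 * X 2 ^ 2 + C (3 * c + 9) * X 1 ^ 2 * X 2 ^ 2 +
    4 * X 2 ^ 4

/-- `C₂ = 4x⁴+(15c+25)y⁴+(5c−1)x²y²+(3c+9)x²z²+(5c−1)y²z²+4z⁴`. -/
def C₂ {F : Type*} [Field F] (c : F) : MvPolynomial (Fin 3) F :=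
  4 * X 0 ^ 4 + C (15 * c + 25) * X 1 ^ 4 + C (5 * c - 1) * X 0 ^ 2 * X 1 ^ 2 +
    C (3 * c + 9) * X 0 ^ 2 * X 2 ^ 2 + C (5 * c - 1) * X 1 ^ 2 * X 2 ^ 2 +
    4 * X 2 ^ 4

/-- `D₃ = (15c+21)x²+(15c+21)y²+(2c−10)z²`. -/
def D₃ {F : Type*} [Field F] (c : F) : MvPolynomial (Fin 3) F :=
  C (15 * c + 21) * X 0 ^ 2 + C (15 * c + 21) * X 1 ^ 2 + C (2 * c - 10) * X 2 ^ 2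

/-- `D₁ = (2c−10)x²+(15c+21)y²+(15c+21)z²`. -/
def D₁ {F : Type*} [Field F] (c : F) : MvPolynomial (Fin 3) F :=
  C (2 * c - 10) * X 0 ^ 2 + C (15 * c + 21) * X 1 ^ 2 + C (15 * c + 21) * X 2 ^ 2

/-- `D₂ = (15c+21)x²+(2c−10)y²+(15c+21)z²`. -/
def D₂ {F : Type*} [Field F] (c : F) : MvPolynomial (Fin 3) F :=
  C (15 * c + 21) * X 0 ^ 2 + C (2 * c - 10) * X 1 ^ 2 + C (15 * c + 21) * X 2 ^ 2

/-- `f = xy(x²−y²)C₃`. -/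
def kf {F : Type*} [Field F] (c : F) : MvPolynomial (Fin 3) F :=
  X 0 * X 1 * (X 0 ^ 2 - X 1 ^ 2) * C₃ c

/-- `g = yz(y²−z²)C₁`. -/
def kg {F : Type*} [Field F] (c : F) : MvPolynomial (Fin 3) F :=
  X 1 * X 2 * (X 1 ^ 2 - X 2 ^ 2) * C₁ c

/-- `h = zx(z²−x²)C₂`. -/
def kh {F : Type*} [Field F] (c : F) : MvPolynomial (Fin 3) F :=
  X 2 * X 0 * (X 2 ^ 2 - X 0 ^ 2) * C₂ c

/-- The degree-3 syzygy `(P₁,P₂,P₃) = (zD₃, xD₁, yD₂)`. -/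
def kP {F : Type*} [Field F] (c : F) : Fin 3 → MvPolynomial (Fin 3) F :=
  ![X 2 * D₃ c, X 0 * D₁ c, X 1 * D₂ c]

/-- The degree-5 syzygy `(Q₁,Q₂,Q₃) = (zC₂, xC₂, y((y²−z²)D₂ + C₃))`. -/
def kQ {F : Type*} [Field F] (c : F) : Fin 3 → MvPolynomial (Fin 3) F :=
  ![X 2 * C₂ c, X 0 * C₂ c, X 1 * ((X 1 ^ 2 - X 2 ^ 2) * D₂ c + C₃ c)]

section Spanning

variable {F : Type*} [Field F]

/-- The quadratic form `(2c−10)u²+(15c+21)(v²+w²)`, of which the `Dᵢ` are instances. -/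
def quadD (c : F) (u v w : MvPolynomial (Fin 3) F) : MvPolynomial (Fin 3) F :=
  C (2 * c - 10) * u ^ 2 + C (15 * c + 21) * (v ^ 2 + w ^ 2)

/-- The quartic form with distinguished variable `v`, of which the `Cᵢ` are instances. -/
def quartC (c : F) (u v w : MvPolynomial (Fin 3) F) : MvPolynomial (Fin 3) F :=
  C (15 * c + 25) * v ^ 4 + 4 * (u ^ 4 + w ^ 4) + C (5 * c - 1) * (u ^ 2 + w ^ 2) * v ^ 2 +
    C (3 * c + 9) * u ^ 2 * w ^ 2

theorem exists_sub_C_mul_mem {I : Ideal (MvPolynomial (Fin 3) F)} (h2 : (2 : F) ≠ 0)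
    (h7 : (7 : F) ≠ 0) (k : ℕ) (a : F) {m q r : MvPolynomial (Fin 3) F} (hr : r ∈ I)
    (h : 2 ^ k * 7 * m - C a * q = r) : ∃ b : F, m - C b * q ∈ I := by
  have hn : (2 ^ k * 7 : F) ≠ 0 := mul_ne_zero (pow_ne_zero _ h2) h7
  refine ⟨(2 ^ k * 7)⁻¹ * a, ?_⟩
  have hC : C (2 ^ k * 7 : F)⁻¹ * (2 ^ k * 7) = (1 : MvPolynomial (Fin 3) F) := by
    rw [← C_1, ← inv_mul_cancel₀ hn]
    simp only [map_mul, map_pow, map_ofNat]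
  have := I.mul_mem_left (C (2 ^ k * 7 : F)⁻¹) hr
  rw [← h] at this
  convert this using 1
  rw [C_mul]
  linear_combination -m * hC

variable {c : F} {I : Ideal (MvPolynomial (Fin 3) F)} {u v w : MvPolynomial (Fin 3) F}

theorem combination_mem (hu : u * quadD c u v w ∈ I) (hv : v * quadD c v u w ∈ I)
    (hw : w * quadD c w u v ∈ I) (p q r : MvPolynomial (Fin 3) F) :
    p * (u * quadD c u v w) + q * (v * quadD c v u w) + r * (w * quadD c w u v) ∈ I :=
  I.add_mem (I.add_mem (I.mul_mem_left _ hu) (I.mul_mem_left _ hv)) (I.mul_mem_left _ hw)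

theorem C_root (hc : c ^ 2 + c + 2 = 0) :
    (C c ^ 2 + C c + 2 : MvPolynomial (Fin 3) F) = 0 := by
  simpa only [map_add, map_pow, map_ofNat, map_zero] using
    congrArg (C : F →+* MvPolynomial (Fin 3) F) hc

theorem exists_monomial_sub_mem (hc : c ^ 2 + c + 2 = 0) (h2 : (2 : F) ≠ 0) (h7 : (7 : F) ≠ 0)
    (hu : u * quadD c u v w ∈ I) (hv : v * quadD c v u w ∈ I) (hw : w * quadD c w u v ∈ I)
    {i j k : ℕ} (h : i + j + k = 5) (hi : Odd i) (hj : Even j) (hk : Even k) :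
    ∃ b : F, u ^ i * v ^ j * w ^ k - C b * (u * quartC c u v w) ∈ I := by
  have hγ := C_root hc
  have mem := combination_mem hu hv hw
  obtain ⟨i, rfl⟩ := hi
  obtain ⟨j, rfl⟩ := hj
  obtain ⟨k, rfl⟩ := hk
  have hcases : (i = 2 ∧ j = 0 ∧ k = 0) ∨ (i = 1 ∧ j = 1 ∧ k = 0) ∨ (i = 1 ∧ j = 0 ∧ k = 1) ∨
      (i = 0 ∧ j = 2 ∧ k = 0) ∨ (i = 0 ∧ j = 0 ∧ k = 2) ∨ (i = 0 ∧ j = 1 ∧ k = 1) := by omega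
  rcases hcases with h | h | h | h | h | h <;> obtain ⟨rfl, rfl, rfl⟩ := h
  · refine exists_sub_C_mul_mem h2 h7 10 (576 + 144 * c) (mem
        ((-474 - 31 * C c) * u ^ 2 + (-600 - 180 * C c) * v ^ 2 + (-24 - 36 * C c) * w ^ 2)
        ((270 + 45 * C c) * (u * v))
        ((270 + 45 * C c) * (u * w))) ?_
    simp only [quadD, quartC, map_add, map_sub, map_mul, map_ofNat, map_one]
    linear_combination (450 * u * w ^ 4 + 1170 * u * v ^ 2 * w ^ 2 - 570 * u ^ 3 * w ^ 2 +
          450 * u * v ^ 4 - 570 * u ^ 3 * v ^ 2 + 62 * u ^ 5) * hγ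
  · refine exists_sub_C_mul_mem h2 h7 11 (96 - 144 * c) (mem
        ((54 - 39 * C c) * u ^ 2 + (73 * C c - 234) * v ^ 2 + (90 + 63 * C c) * w ^ 2)
        ((60 - 246 * C c) * (u * v))
        (96 * C c * (u * w))) ?_
    simp only [quadD, quartC, map_add, map_sub, map_mul, map_ofNat, map_one]
    linear_combination (-1137 * u * w ^ 4 + 930 * u * v ^ 2 * w ^ 2 - 549 * u ^ 3 * w ^ 2 +
          1557 * u * v ^ 4 + 4849 * u ^ 3 * v ^ 2 + 78 * u ^ 5) * hγ
  · refine exists_sub_C_mul_mem h2 h7 11 (96 - 144 * c) (mem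
        ((54 - 39 * C c) * u ^ 2 + (207 * C c - 6) * v ^ 2 + (-138 - 71 * C c) * w ^ 2)
        (96 * C c * (u * v))
        ((60 - 246 * C c) * (u * w))) ?_
    simp only [quadD, quartC, map_add, map_sub, map_mul, map_ofNat, map_one]
    linear_combination (1557 * u * w ^ 4 + 930 * u * v ^ 2 * w ^ 2 + 4849 * u ^ 3 * w ^ 2 -
          1137 * u * v ^ 4 - 549 * u ^ 3 * v ^ 2 + 78 * u ^ 5) * hγ
  · refine exists_sub_C_mul_mem h2 h7 11 (96 - 144 * c) (mem
        ((54 - 39 * C c) * u ^ 2 + (54 - 135 * C c) * v ^ 2 + (90 + 63 * C c) * w ^ 2)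
        ((-228 - 38 * C c) * (u * v))
        (96 * C c * (u * w))) ?_
    simp only [quadD, quartC, map_add, map_sub, map_mul, map_ofNat, map_one]
    linear_combination (-1137 * u * w ^ 4 + 930 * u * v ^ 2 * w ^ 2 - 549 * u ^ 3 * w ^ 2 +
          4261 * u * v ^ 4 + 2145 * u ^ 3 * v ^ 2 + 78 * u ^ 5) * hγ
  · refine exists_sub_C_mul_mem h2 h7 11 (96 - 144 * c) (mem
        ((54 - 39 * C c) * u ^ 2 + (207 * C c - 6) * v ^ 2 + (150 - 279 * C c) * w ^ 2)
        (96 * C c * (u * v))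
        ((-228 - 38 * C c) * (u * w))) ?_
    simp only [quadD, quartC, map_add, map_sub, map_mul, map_ofNat, map_one]
    linear_combination (4261 * u * w ^ 4 + 930 * u * v ^ 2 * w ^ 2 + 2145 * u ^ 3 * w ^ 2 -
          1137 * u * v ^ 4 - 549 * u ^ 3 * v ^ 2 + 78 * u ^ 5) * hγ
  · refine exists_sub_C_mul_mem h2 h7 8 (8 * c - 24) (mem
        ((C c - 10) * u ^ 2 + (18 - 17 * C c) * v ^ 2 + (-6 - 9 * C c) * w ^ 2)
        ((8 - 8 * C c) * (u * v))
        ((8 - 8 * C c) * (u * w))) ?_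
    simp only [quadD, quartC, map_add, map_sub, map_mul, map_ofNat, map_one]
    linear_combination (151 * u * w ^ 4 + 590 * u * v ^ 2 * w ^ 2 + 99 * u ^ 3 * w ^ 2 +
          151 * u * v ^ 4 + 99 * u ^ 3 * v ^ 2 - 2 * u ^ 5) * hγ

theorem cube_mul_mul_mem (hc : c ^ 2 + c + 2 = 0) (h2 : (2 : F) ≠ 0) (h7 : (7 : F) ≠ 0)
    (hu : u * quadD c u v w ∈ I) (hv : v * quadD c v u w ∈ I) (hw : w * quadD c w u v ∈ I) :
    u ^ 3 * v * w ∈ I := by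
  have hγ := C_root hc
  have mem := combination_mem hu hv hw
  obtain ⟨b, hb⟩ : ∃ b : F, u ^ 3 * v * w - C b * 0 ∈ I := by
    refine exists_sub_C_mul_mem h2 h7 7 0 (mem
        ((4 * C c - 12) * (v * w))
        ((6 - 9 * C c) * (u * w))
        ((6 - 9 * C c) * (u * v))) ?_
    simp only [quadD, map_add, map_sub, map_mul, map_ofNat, map_zero]
    linear_combination (93 * u * v * w ^ 3 + 93 * u * v ^ 3 * w + 262 * u ^ 3 * v * w) * hγ
  simpa using hb

end Spanning

section Quintics

variable {F : Type*} [Field F] (c : F)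

theorem kP_mem (j : Fin 3) : kP c j ∈ Ideal.span {kP c 0, kP c 1, kP c 2} := by
  apply Ideal.subset_span
  fin_cases j <;> simp

theorem kQ_mem (j : Fin 3) : kQ c j ∈ Submodule.span F {kQ c 0, kQ c 1, kQ c 2} := by
  apply Submodule.subset_span
  fin_cases j <;> simp

theorem kP_zero : kP c 0 = X 2 * quadD c (X 2) (X 0) (X 1) := by
  simp only [kP, D₃, quadD, Matrix.cons_val]
  ring

theorem kP_one : kP c 1 = X 0 * quadD c (X 0) (X 1) (X 2) := by
  simp only [kP, D₁, quadD, Matrix.cons_val]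
  ring

theorem kP_two : kP c 2 = X 1 * quadD c (X 1) (X 0) (X 2) := by
  simp only [kP, D₂, quadD, Matrix.cons_val]
  ring

theorem kQ_zero : kQ c 0 = X 2 * quartC c (X 2) (X 1) (X 0) := by
  simp only [kQ, C₂, quartC, Matrix.cons_val]
  ring

theorem kQ_one : kQ c 1 = X 0 * quartC c (X 0) (X 1) (X 2) := by
  simp only [kQ, C₂, quartC, Matrix.cons_val]
  ring

theorem kQ_two :
    kQ c 2 = X 1 * quartC c (X 1) (X 2) (X 0) + (X 1 ^ 2 - X 2 ^ 2) * kP c 2 := by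
  simp only [kQ, kP, C₃, quartC, Matrix.cons_val]
  ring

theorem isHomogeneous_quadD (i j k : Fin 3) :
    (quadD c (X i) (X j) (X k)).IsHomogeneous 2 :=
  (isHomogeneous_C_mul_X_pow _ _ _).add
    (((isHomogeneous_X_pow _ _).add (isHomogeneous_X_pow _ _)).C_mul _)

theorem isHomogeneous_quartC (i j k : Fin 3) :
    (quartC c (X i) (X j) (X k)).IsHomogeneous 4 := by
  rw [quartC, ← map_ofNat (C : F →+* MvPolynomial (Fin 3) F) 4]
  refine .add (.add (.add ?_ ?_) ?_) ?_
  · exact isHomogeneous_C_mul_X_pow _ _ _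
  · exact ((isHomogeneous_X_pow _ _).add (isHomogeneous_X_pow _ _)).C_mul _
  · exact (((isHomogeneous_X_pow _ _).add (isHomogeneous_X_pow _ _)).C_mul _).mul
      (isHomogeneous_X_pow _ _)
  · exact (isHomogeneous_C_mul_X_pow _ _ _).mul (isHomogeneous_X_pow _ _)

theorem isHomogeneous_kQ (j : Fin 3) : (kQ c j).IsHomogeneous 5 := by
  fin_cases j
  · exact kQ_zero c ▸ (isHomogeneous_X F 2).mul (isHomogeneous_quartC c _ _ _)
  · exact kQ_one c ▸ (isHomogeneous_X F 0).mul (isHomogeneous_quartC c _ _ _)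
  · simp only [Fin.reduceFinMk, kQ_two, kP_two]
    exact ((isHomogeneous_X F 1).mul (isHomogeneous_quartC c _ _ _)).add
      (((isHomogeneous_X_pow _ 2).sub (isHomogeneous_X_pow _ 2)).mul
        ((isHomogeneous_X F 1).mul (isHomogeneous_quadD c _ _ _)))

variable {c}

theorem exists_sub_mem_span_kP (hc : c ^ 2 + c + 2 = 0) (h2 : (2 : F) ≠ 0) (h7 : (7 : F) ≠ 0)
    {i j k : ℕ} (h : i + j + k = 5) :
    ∃ q ∈ Submodule.span F {kQ c 0, kQ c 1, kQ c 2},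
      (X 0 ^ i * X 1 ^ j * X 2 ^ k : MvPolynomial (Fin 3) F) - q ∈
        Ideal.span {kP c 0, kP c 1, kP c 2} := by
  set I := Ideal.span {kP c 0, kP c 1, kP c 2}
  have hD {a b d : MvPolynomial (Fin 3) F} (h : a * quadD c a b d ∈ I) :
      a * quadD c a d b ∈ I := by
    simpa only [quadD, add_comm (b ^ 2)] using h
  have hz : X 2 * quadD c (X 2) (X 0) (X 1) ∈ I := kP_zero c ▸ kP_mem c 0
  have hx : X 0 * quadD c (X 0) (X 1) (X 2) ∈ I := kP_one c ▸ kP_mem c 1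
  have hy : X 1 * quadD c (X 1) (X 0) (X 2) ∈ I := kP_two c ▸ kP_mem c 2
  have hP : kP c 2 ∈ I := kP_mem c 2
  have smul_mem (b : F) (j : Fin 3) :
      C b * kQ c j ∈ Submodule.span F {kQ c 0, kQ c 1, kQ c 2} := by
    rw [C_mul']
    exact Submodule.smul_mem _ _ (kQ_mem c j)
  rcases Nat.even_or_odd i with hi | hi <;> rcases Nat.even_or_odd j with hj | hj <;>
    rcases Nat.even_or_odd k with hk | hk
  · grind
  · obtain ⟨b, hb⟩ := exists_monomial_sub_mem hc h2 h7 (hD hz) (hD hy) (hD hx)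
      (by omega : k + j + i = 5) hk hj hi
    refine ⟨_, smul_mem b 0, ?_⟩
    rw [kQ_zero]
    convert hb using 1
    ring
  · obtain ⟨b, hb⟩ := exists_monomial_sub_mem hc h2 h7 (hD hy) (hD hz) hx
      (by omega : j + k + i = 5) hj hk hi
    refine ⟨_, smul_mem b 2, ?_⟩
    rw [kQ_two]
    convert I.add_mem hb (I.mul_mem_left (C (-b) * (X 1 ^ 2 - X 2 ^ 2)) hP) using 1
    rw [C_neg]
    ring
  · grind
  · obtain ⟨b, hb⟩ := exists_monomial_sub_mem hc h2 h7 hx hy hz h hi hj hk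
    refine ⟨_, smul_mem b 1, ?_⟩
    rwa [kQ_one]
  · grind
  · grind
  · refine ⟨0, Submodule.zero_mem _, ?_⟩
    rw [sub_zero]
    obtain ⟨i, rfl⟩ := hi
    obtain ⟨j, rfl⟩ := hj
    obtain ⟨k, rfl⟩ := hk
    have hcases : (i = 1 ∧ j = 0 ∧ k = 0) ∨ (i = 0 ∧ j = 1 ∧ k = 0) ∨
        (i = 0 ∧ j = 0 ∧ k = 1) := by omega
    rcases hcases with h | h | h <;> obtain ⟨rfl, rfl, rfl⟩ := h
    · convert cube_mul_mul_mem hc h2 h7 hx hy hz using 1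
      ring
    · convert cube_mul_mul_mem hc h2 h7 hy hx (hD hz) using 1
      ring
    · convert cube_mul_mul_mem hc h2 h7 (hD hz) (hD hy) (hD hx) using 1
      ring

end Quintics

section Dual

variable {F : Type*} [Field F] (c : F)

/-- The exponent vector of `xⁱyʲzᵏ`. -/
def expo (i j k : ℕ) : Fin 3 →₀ ℕ :=
  Finsupp.equivFunOnFinite.symm ![i, j, k]

theorem coeff_expo_mul_X_pow (i j k : ℕ) (s : Fin 3) (n : ℕ) (p : MvPolynomial (Fin 3) F) :
    coeff (expo i j k) (p * X s ^ n) =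
      if n ≤ expo i j k s then coeff (expo i j k - Finsupp.single s n) p else 0 := by
  rw [X_pow_eq_monomial, coeff_mul_monomial', mul_one]
  simp only [Finsupp.single_le_iff]

theorem coeff_expo_mul_X_zero_pow (i j k n : ℕ) (p : MvPolynomial (Fin 3) F) :
    coeff (expo i j k) (p * X 0 ^ n) = if n ≤ i then coeff (expo (i - n) j k) p else 0 := by
  rw [coeff_expo_mul_X_pow]
  congr 2
  ext s
  fin_cases s <;> simp [expo]

theorem coeff_expo_mul_X_one_pow (i j k n : ℕ) (p : MvPolynomial (Fin 3) F) :
    coeff (expo i j k) (p * X 1 ^ n) = if n ≤ j then coeff (expo i (j - n) k) p else 0 := by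
  rw [coeff_expo_mul_X_pow]
  congr 2
  ext s
  fin_cases s <;> simp [expo]

theorem coeff_expo_mul_X_two_pow (i j k n : ℕ) (p : MvPolynomial (Fin 3) F) :
    coeff (expo i j k) (p * X 2 ^ n) = if n ≤ k then coeff (expo i j (k - n)) p else 0 := by
  rw [coeff_expo_mul_X_pow]
  congr 2
  ext s
  fin_cases s <;> simp [expo]

theorem coeff_expo_zero_one : coeff (expo 0 0 0) (1 : MvPolynomial (Fin 3) F) = 1 := by
  convert coeff_zero_one
  ext s
  fin_cases s <;> simp [expo]

/-- The functionals on quintics that vanish on `(P)₅` and are dual to the `Qᵢ` up to a scalar. -/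
def dual (p : MvPolynomial (Fin 3) F) : Fin 3 → F :=
  ![(72 + 18 * c) * coeff (expo 0 0 5) p +
      (6 - 9 * c) * (coeff (expo 0 2 3) p + coeff (expo 0 4 1) p + coeff (expo 2 0 3) p +
        coeff (expo 4 0 1) p) + (4 * c - 12) * coeff (expo 2 2 1) p,
    (72 + 18 * c) * coeff (expo 5 0 0) p +
      (6 - 9 * c) * (coeff (expo 1 0 4) p + coeff (expo 1 4 0) p + coeff (expo 3 0 2) p +
        coeff (expo 3 2 0) p) + (4 * c - 12) * coeff (expo 1 2 2) p,
    (72 + 18 * c) * coeff (expo 0 5 0) p +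
      (6 - 9 * c) * (coeff (expo 0 1 4) p + coeff (expo 0 3 2) p + coeff (expo 2 3 0) p +
        coeff (expo 4 1 0) p) + (4 * c - 12) * coeff (expo 2 1 2) p]

theorem dual_add (p q : MvPolynomial (Fin 3) F) : dual c (p + q) = dual c p + dual c q := by
  ext i
  fin_cases i <;> simp [dual] <;> ring

theorem dual_C_mul (a : F) (p : MvPolynomial (Fin 3) F) : dual c (C a * p) = a • dual c p := by
  ext i
  fin_cases i <;> simp [dual, coeff_C_mul] <;> ring

variable {c}

theorem mul_mul_quadD (p u v w : MvPolynomial (Fin 3) F) :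
    p * (u * quadD c u v w) = C (2 * c - 10) * (p * u ^ 3) +
      C (15 * c + 21) * (p * u ^ 1 * v ^ 2) + C (15 * c + 21) * (p * u ^ 1 * w ^ 2) := by
  rw [quadD]
  ring

theorem mul_quartC (u v w : MvPolynomial (Fin 3) F) :
    u * quartC c u v w = C (15 * c + 25) * (1 * u ^ 1 * v ^ 4) + C 4 * (1 * u ^ 5) +
      C 4 * (1 * u ^ 1 * w ^ 4) + C (5 * c - 1) * (1 * u ^ 3 * v ^ 2) +
      C (5 * c - 1) * (1 * u ^ 1 * v ^ 2 * w ^ 2) + C (3 * c + 9) * (1 * u ^ 3 * w ^ 2) := by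
  rw [quartC, map_ofNat]
  ring

theorem dual_mul_kP (hc : c ^ 2 + c + 2 = 0) (p : MvPolynomial (Fin 3) F) (j : Fin 3) :
    dual c (p * kP c j) = 0 := by
  ext i
  fin_cases j <;>
    simp only [Fin.zero_eta, Fin.mk_one, Fin.reduceFinMk, kP_zero, kP_one, kP_two,
      mul_mul_quadD, dual_add, dual_C_mul] <;>
    fin_cases i <;>
    simp only [dual, coeff_expo_mul_X_zero_pow, coeff_expo_mul_X_one_pow,
      coeff_expo_mul_X_two_pow] <;>
    simp <;>
    grind

theorem dual_mem_span_kP (hc : c ^ 2 + c + 2 = 0) {p : MvPolynomial (Fin 3) F}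
    (hp : p ∈ Ideal.span {kP c 0, kP c 1, kP c 2}) : dual c p = 0 := by
  obtain ⟨a, b, d, rfl⟩ := Submodule.mem_span_triple.1 hp
  simp only [smul_eq_mul, dual_add, dual_mul_kP hc, add_zero]

theorem dual_kQ (hc : c ^ 2 + c + 2 = 0) (j : Fin 3) : dual c (kQ c j) = Pi.single j 896 := by
  ext i
  fin_cases j <;>
    simp only [Fin.zero_eta, Fin.mk_one, Fin.reduceFinMk, kQ_zero, kQ_one, kQ_two, dual_add,
      dual_mul_kP hc, add_zero, mul_quartC, dual_C_mul] <;>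
    fin_cases i <;>
    simp only [dual, coeff_expo_mul_X_zero_pow, coeff_expo_mul_X_one_pow,
      coeff_expo_mul_X_two_pow] <;>
    simp [coeff_expo_zero_one] <;>
    grind

theorem eq_zero_of_sum_smul_mem (hc : c ^ 2 + c + 2 = 0) (h2 : (2 : F) ≠ 0) (h7 : (7 : F) ≠ 0)
    {a : Fin 3 → F} (ha : ∑ i, a i • kQ c i ∈ Ideal.span {kP c 0, kP c 1, kP c 2}) :
    a = 0 := by
  have h896 : (896 : F) ≠ 0 := by
    rw [show (896 : F) = 2 ^ 7 * 7 by norm_num]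
    exact mul_ne_zero (pow_ne_zero _ h2) h7
  have := dual_mem_span_kP hc ha
  simp only [Fin.sum_univ_three, smul_eq_C_mul, dual_add, dual_C_mul, dual_kQ hc] at this
  ext i
  have hi := congrFun this i
  fin_cases i <;> simpa [h896] using hi

end Dual

/-- the space `R₅` of homogeneous quintics decomposes as
`span{Q₁,Q₂,Q₃} ⊕ (P)₅`; in particular the `Qᵢ` are linearly independent and no
nonzero linear combination of them lies in `P = (P₁,P₂,P₃)`. -/
theorem klein_R5_decomposition {F : Type*} [Field F] (c : F)
    (hc : c ^ 2 + c + 2 = 0) (h2 : ringChar F ≠ 2) (h3 : ringChar F ≠ 3)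
    (h7 : ringChar F ≠ 7) :
    let R' := MvPolynomial (Fin 3) F
    let P : Ideal R' := Ideal.span {kP c 0, kP c 1, kP c 2}
    let SQ : Submodule F R' := Submodule.span F {kQ c 0, kQ c 1, kQ c 2}
    let SP : Submodule F R' :=
      (Submodule.restrictScalars F P) ⊓ homogeneousSubmodule (Fin 3) F 5
    SQ ⊓ SP = ⊥ ∧ SQ ⊔ SP = homogeneousSubmodule (Fin 3) F 5 ∧
      LinearIndependent F (kQ c) ∧
      ∀ a : Fin 3 → F, (∑ i, MvPolynomial.C (a i) * kQ c i) ∈ P → a = 0 := by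
  intro R' P SQ SP
  have two_ne : (2 : F) ≠ 0 := Ring.two_ne_zero h2
  have seven_ne : (7 : F) ≠ 0 := fun h ↦ by
    have hdvd : ringChar F ∣ 7 := (ringChar.spec F 7).1 (by exact_mod_cast h)
    rcases (Nat.dvd_prime (by norm_num)).1 hdvd with h | h
    exacts [CharP.ringChar_ne_one h, h7 h]
  have indep (a : Fin 3 → F) (ha : ∑ i, a i • kQ c i ∈ P) : a = 0 :=
    eq_zero_of_sum_smul_mem hc two_ne seven_ne ha
  have hSQ : SQ ≤ homogeneousSubmodule (Fin 3) F 5 := by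
    rw [Submodule.span_le]
    rintro _ (rfl | rfl | rfl) <;> exact isHomogeneous_kQ c _
  refine ⟨?_, le_antisymm (sup_le hSQ inf_le_right) fun p hp ↦ ?_, ?_,
    fun a ha ↦ indep a (by simpa only [smul_eq_C_mul] using ha)⟩
  · rw [eq_bot_iff]
    rintro _ ⟨hq, hP, -⟩
    obtain ⟨a, b, d, rfl⟩ := Submodule.mem_span_triple.1 hq
    have h := indep ![a, b, d] (by
      rw [Fin.sum_univ_three]
      exact hP)
    have ha : a = 0 := congrFun h 0
    have hb : b = 0 := congrFun h 1
    have hd : d = 0 := congrFun h 2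
    simp [ha, hb, hd]
  · rw [p.as_sum]
    refine Submodule.sum_mem _ fun s hs ↦ ?_
    have hdeg : s 0 + s 1 + s 2 = 5 := by
      have := IsHomogeneous.degree_eq_sum_deg_support hp hs
      rw [← Finsupp.degree_apply, Finsupp.degree_eq_sum, Fin.sum_univ_three] at this
      exact this.symm
    obtain ⟨q, hq, hqP⟩ := exists_sub_mem_span_kP hc two_ne seven_ne hdeg
    have hmon : monomial s (coeff s p) =
        coeff s p • (X 0 ^ s 0 * X 1 ^ s 1 * X 2 ^ s 2 : MvPolynomial (Fin 3) F) := by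
      rw [monomial_eq, Finsupp.prod_fintype _ _ (fun _ ↦ pow_zero _), Fin.prod_univ_three, C_mul']
    have hhom : (X 0 ^ s 0 * X 1 ^ s 1 * X 2 ^ s 2 : MvPolynomial (Fin 3) F).IsHomogeneous 5 :=
      hdeg ▸ ((isHomogeneous_X_pow _ _).mul (isHomogeneous_X_pow _ _)).mul
        (isHomogeneous_X_pow _ _)
    rw [hmon]
    exact Submodule.smul_mem _ _
      (Submodule.mem_sup.2 ⟨q, hq, _, ⟨hqP, hhom.sub (hSQ hq)⟩, add_sub_cancel _ _⟩)
  · rw [Fintype.linearIndependent_iff]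
    intro a ha
    exact congrFun (indep a (ha ▸ P.zero_mem))

end
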